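/- arXiv:2104.11630 — 3 statements merged into one kernel-verified Lean document; each statement's English description precedes it below -/
import Mathlib

section
/- For every r ∈ (0,1), one has α < f₁(r) < β, where f₁(r) = f(r)/r⁴, α = 85π/8 − 185π²/32 + 25π³/32 and β = (8 − 10 log 2)π − 85π²/32 + 25π³/32. -/
open Real Set Filter Topology

/-- The complete elliptic integral of the first kind. -/
noncomputable def K (r : ℝ) : ℝ :=
  ∫ t in (0:ℝ)..(π/2), (1 - r^2 * Real.sin t ^ 2) ^ (-(1:ℝ)/2)

/-- `θ = π(17 - 5π)/32`. -/
noncomputable def θ : ℝ := π * (17 - 5*π) / 32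

noncomputable def f (r : ℝ) : ℝ :=
  (π/2) * (16 - 5 * Real.log (1 - r^2)) - (θ * r^2 + K r) * (16 + (5*π - 16) * r^2)

noncomputable def f₁ (r : ℝ) : ℝ := f r / r^4

noncomputable def ww (n : ℕ) : ℝ := ∏ i ∈ Finset.range n, ((2:ℝ) * i + 1) / (2 * i + 2)

lemma ww_succ (n : ℕ) : ww (n+1) = ww n * (((2:ℝ) * n + 1) / (2 * n + 2)) := by
  unfold ww; rw [Finset.prod_range_succ]

lemma ww_pos (n : ℕ) : 0 < ww n := by
  unfold ww; apply Finset.prod_pos; intros; positivity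

lemma ww_le_one (n : ℕ) : ww n ≤ 1 := by
  induction n with
  | zero => simp [ww]
  | succ n ih =>
    rw [ww_succ]
    have : ((2:ℝ) * n + 1) / (2 * n + 2) ≤ 1 := by
      rw [div_le_one (by positivity)]; linarith
    have h0 : 0 ≤ ((2:ℝ) * n + 1) / (2 * n + 2) := by positivity
    have := ww_pos n
    nlinarith

lemma ww_wallis (n : ℕ) : ww n ^ 2 * (2 * n + 1) * Real.Wallis.W n = 1 := by
  induction n with
  | zero => simp [ww, Real.Wallis.W]
  | succ n ih =>
    rw [ww_succ, Real.Wallis.W_succ]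
    have e : (ww n * ((2 * (n:ℝ) + 1) / (2 * n + 2))) ^ 2 * (2 * ((n + 1 : ℕ) : ℝ) + 1) *
      (Real.Wallis.W n * ((2 * n + 2) / (2 * n + 1) * ((2 * n + 2) / (2 * n + 3))))
      = ww n ^ 2 * (2 * n + 1) * Real.Wallis.W n := by
      push_cast
      field_simp
      ring
    rw [e, ih]

lemma ww_bound (n : ℕ) : ww n ^ 2 * (n + 1/4) ≤ 1 / π := by
  have hm : Monotone (fun n : ℕ => ww n ^ 2 * ((n:ℝ) + 1/4)) := by
    apply monotone_nat_of_le_succ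
    intro n
    rw [ww_succ, mul_pow, mul_assoc]
    apply mul_le_mul_of_nonneg_left _ (sq_nonneg _)
    push_cast
    rw [div_pow, div_mul_eq_mul_div, le_div_iff₀ (by positivity)]
    nlinarith
  have ht : Tendsto (fun n : ℕ => ww n ^ 2 * ((n:ℝ) + 1/4)) atTop (𝓝 (1/π)) := by
    have h1 : Tendsto (fun n : ℕ => (1:ℝ)/2 - (1/4) * (1 / (2 * n + 1)))
        atTop (𝓝 (1/2 - (1/4) * 0)) := by
      apply Tendsto.const_sub
      apply Tendsto.const_mul
      apply Tendsto.div_atTop tendsto_const_nhds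
      apply tendsto_atTop_add_const_right
      exact Tendsto.const_mul_atTop (by norm_num) tendsto_natCast_atTop_atTop
    have h2 := h1.div Real.Wallis.tendsto_W_nhds_pi_div_two (by positivity)
    have e : (1/2 - (1/4) * 0) / (π/2) = 1/π := by field_simp; norm_num
    rw [e] at h2
    refine h2.congr (fun n => ?_)
    have hw := ww_wallis n
    have hW := Real.Wallis.W_pos n
    have : ww n ^ 2 = 1 / ((2 * n + 1) * Real.Wallis.W n) := by
      rw [eq_div_iff (by positivity)]; linarith
    simp only [Pi.div_apply]
    rw [this]
    field_simp
    ring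
  exact hm.ge_of_tendsto ht n

lemma int_sin (n : ℕ) : ∫ t in (0:ℝ)..(π/2), Real.sin t ^ (2*n) = (π/2) * ww n := by
  induction n with
  | zero => simp [ww]
  | succ n ih =>
    rw [show 2 * (n+1) = 2*n+2 by ring, integral_sin_pow, ih, ww_succ]
    simp
    ring

lemma choose_ww (n : ℕ) : Ring.choose (-(1:ℝ)/2) n * (-1)^n = ww n := by
  have key : ∀ n : ℕ, ((n:ℝ)+1) * Ring.choose (-(1:ℝ)/2) (n+1) = (-(1:ℝ)/2 - n) * Ring.choose (-(1:ℝ)/2) n := by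
    intro n
    have h1 := Ring.descPochhammer_eq_factorial_smul_choose (-(1:ℝ)/2) n
    have h2 := Ring.descPochhammer_eq_factorial_smul_choose (-(1:ℝ)/2) (n+1)
    rw [descPochhammer_succ_right, Polynomial.smeval_mul, h1] at h2
    simp [Polynomial.smeval_sub, Polynomial.smeval_natCast, Nat.factorial_succ] at h2
    have : (n.factorial : ℝ) ≠ 0 := by positivity
    apply mul_left_cancel₀ this
    linarith
  induction n with
  | zero => simp [ww]
  | succ n ih =>
    rw [ww_succ, ← ih]
    have := key n
    have h : Ring.choose (-(1:ℝ)/2) (n+1) = (-(1:ℝ)/2 - n) * Ring.choose (-(1:ℝ)/2) n / (n+1) := by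
      rw [eq_div_iff (by positivity)]; linarith
    rw [h]
    field_simp
    ring

lemma series_rpow (y : ℝ) (h0 : 0 ≤ y) (h1 : y < 1) :
    HasSum (fun n : ℕ => ww n * y ^ n) ((1 - y) ^ (-(1:ℝ)/2)) := by
  have := (Real.one_add_rpow_hasFPowerSeriesOnBall_zero (a := -(1:ℝ)/2)).hasSum (y := -y)
    (by simp; rw [Real.enorm_eq_ofReal h0]; simpa using h1)
  simp only [zero_add, binomialSeries_apply] at this
  rw [sub_eq_add_neg]
  have e : (fun n : ℕ => ww n * y ^ n) = fun n => Ring.choose (-(1:ℝ)/2) n • (List.ofFn fun _ : Fin n => -y).prod := by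
    funext n
    rw [← choose_ww]
    simp [List.ofFn_const]
    rw [neg_pow y]; ring
  rw [e]
  exact this

lemma series_K (r : ℝ) (hr : r ∈ Ioo (0:ℝ) 1) :
    HasSum (fun n : ℕ => (π/2) * ww n ^ 2 * (r^2) ^ n) (K r) := by
  obtain ⟨h0, h1⟩ := hr
  have hx1 : r^2 < 1 := by nlinarith
  have := intervalIntegral.hasSum_integral_of_dominated_convergence (μ := MeasureTheory.volume) (a := 0) (b := π/2)
    (F := fun (n:ℕ) t => ww n * (r^2 * Real.sin t ^ 2)^n)
    (f := fun t => (1 - r^2 * Real.sin t ^ 2) ^ (-(1:ℝ)/2))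
    (fun n _ => (r^2)^n)
    (fun n => (by fun_prop : Continuous _).aestronglyMeasurable)
    (fun n => ?_) ?_ ?_ ?_
  · unfold K
    refine (congrArg (fun g : ℕ → ℝ => HasSum g _) ?_).mpr this
    funext n
    rw [intervalIntegral.integral_const_mul]
    simp_rw [mul_pow, ← pow_mul]
    rw [intervalIntegral.integral_const_mul, int_sin]
    ring
  · refine Eventually.of_forall fun t _ => ?_
    have h2 := Real.sin_sq_le_one t
    rw [Real.norm_of_nonneg (by have := ww_pos n; positivity)]
    calc _ ≤ 1 * (r^2 * 1)^n := by
          gcongr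
          exact ww_le_one n
      _ = _ := by simp
  · exact Eventually.of_forall fun t _ => summable_geometric_of_lt_one (by positivity) hx1
  · simp
  · refine Eventually.of_forall fun t _ => ?_
    have h2 := Real.sin_sq_le_one t
    exact series_rpow _ (by positivity) (by nlinarith [sq_nonneg r])

noncomputable def dd (n : ℕ) : ℝ :=
  5*π/2 * (1 / ((n:ℝ)+3)) - 16 * (π/2 * ww (n+3)^2) - (5*π-16) * (π/2 * ww (n+2)^2)

lemma dd_pos (n : ℕ) : 0 < dd n := by
  have hb := ww_bound (n+2)
  have hW := pow_pos (ww_pos (n+2)) 2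
  unfold dd
  rw [ww_succ (n+2)]
  set W := ww (n+2)
  have hpi := Real.pi_pos
  have hpi2 := Real.pi_lt_d2
  rw [le_div_iff₀ hpi] at hb
  push_cast at hb ⊢
  have hn : (0:ℝ) ≤ n := by positivity
  have key : W^2 * (16 * ((2 * ((n:ℝ)+2) + 1)/(2 * ((n:ℝ)+2) + 2))^2 + 5 * π - 16) < 5 / ((n:ℝ)+3) := by
    calc _ < W^2 * (5 * π * ((n:ℝ)+2+1/4) / (n+3)) := by
          apply mul_lt_mul_of_pos_left _ hW
          have e : 16 * ((2 * ((n:ℝ)+2) + 1)/(2 * ((n:ℝ)+2) + 2))^2 =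
            16 - 16/((n:ℝ)+3) + 4 / ((n:ℝ)+3)^2 := by
            have : (2 * ((n:ℝ)+2) + 2) = 2 * (n+3) := by ring
            rw [this]
            field_simp
            ring
          have e2 : 5 * π * ((n:ℝ)+2+1/4) / (n+3) = 5 * π - 15 * π/4 / (n+3) := by
            field_simp
            ring
          rw [e, e2]
          have h3 : 4 / ((n:ℝ)+3)^2 < (16 - 15*π/4) / (n+3) := by
            rw [div_lt_div_iff₀ (by positivity) (by positivity)]
            have : 4 < (16 - 15*π/4) * (n+3) := by nlinarith
            nlinarith
          rw [sub_div] at h3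
          linarith
      _ = (W^2 * ((n:ℝ)+2+1/4) * π) * 5 / (n+3) := by ring
      _ ≤ 5 / (n+3) := by
          apply div_le_div_of_nonneg_right _ (by positivity)
          linarith
  have : 0 < π/2 * (5 / ((n:ℝ)+3) - W^2 * (16 * ((2 * ((n:ℝ)+2) + 1)/(2 * ((n:ℝ)+2) + 2))^2 + 5 * π - 16)) := by
    apply mul_pos (by positivity); linarith
  refine this.trans_eq ?_
  ring

lemma series_f (r : ℝ) (hr : r ∈ Ioo (0:ℝ) 1) :
    HasSum (fun n : ℕ => dd n * (r^2)^(n+1)) (f₁ r - (85*π/8 - 185*π^2/32 + 25*π^3/32)) := by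
  have hK := series_K r hr
  have hK2 := (hasSum_nat_add_iff' 2).mpr hK
  have hK3 := (hasSum_nat_add_iff' 3).mpr hK
  have hx1 : |r^2| < 1 := by
    rw [abs_of_nonneg (by positivity)]; nlinarith [hr.1, hr.2]
  have hL := (hasSum_nat_add_iff' 2).mpr (Real.hasSum_pow_div_log_of_abs_lt_one hx1)
  have h := (((hL.mul_left (5*π/2)).sub (hK3.mul_left 16)).sub (hK2.mul_left ((5*π-16) * r^2))).mul_left (1/r^4)
  have hr0 : r ≠ 0 := hr.1.ne'
  refine (congrArg₂ (fun (g : ℕ → ℝ) (c : ℝ) => HasSum g c) ?_ ?_).mpr h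
  · funext n
    unfold dd
    push_cast
    have : (n:ℝ) + 2 + 1 = n + 3 := by ring
    rw [this]
    field_simp
    ring
  · simp only [Finset.sum_range_succ, Finset.sum_range_zero, ww, Finset.prod_range_succ, Finset.prod_range_zero, f₁, f, θ]
    push_cast
    field_simp
    ring

lemma K_lower (r : ℝ) (hr : r ∈ Ioo (0:ℝ) 1) :
    Real.log (2 * (1 + r)) - 1/2 * Real.log (1 - r^2) ≤ K r := by
  obtain ⟨h0, h1⟩ := hr
  have hx1 : r^2 < 1 := by nlinarith
  have hR : ∀ t : ℝ, 0 < 1 - r^2 * Real.sin t ^ 2 := fun t => by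
    nlinarith [Real.sin_sq_le_one t, sq_nonneg r]
  have hpi := Real.pi_pos
  have hs0 : ∀ t ∈ Icc (0:ℝ) (π/2), 0 ≤ Real.sin t := fun t ht =>
    Real.sin_nonneg_of_nonneg_of_le_pi ht.1 (by linarith [ht.2])
  have hc0 : ∀ t ∈ Icc (0:ℝ) (π/2), 0 ≤ Real.cos t := fun t ht =>
    Real.cos_nonneg_of_neg_pi_div_two_le_of_le (by linarith [ht.1]) ht.2
  let G : ℝ → ℝ := fun t => Real.log (1 + Real.sin t)
    - Real.log (r * Real.cos t + √(1 - r^2 * Real.sin t ^ 2))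
  let g : ℝ → ℝ := fun t => Real.cos t / (1 + Real.sin t)
    + r * Real.sin t / √(1 - r^2 * Real.sin t ^ 2)
  have hu : uIcc (0:ℝ) (π/2) = Icc 0 (π/2) := uIcc_of_le (by positivity)
  have hG : ∀ t ∈ uIcc (0:ℝ) (π/2), HasDerivAt G (g t) t := by
    intro t ht
    rw [hu] at ht
    have hs := hs0 t ht
    have hc := hc0 t ht
    have hq := Real.sqrt_pos.mpr (hR t)
    have d1 := ((Real.hasDerivAt_sin t).const_add 1).log (by positivity)
    have d2 := (((Real.hasDerivAt_sin t).pow 2).const_mul (r^2)).const_sub 1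
    have d3 := (((Real.hasDerivAt_cos t).const_mul r).add (d2.sqrt (hR t).ne')).log (by
      simp only [Pi.add_apply]
      positivity)
    refine (d1.sub d3).congr_deriv ?_
    simp only [g, Pi.add_apply, Pi.pow_apply]
    have h2 : r * Real.cos t + √(1 - r^2 * Real.sin t ^ 2) ≠ 0 := by positivity
    have h3 : 1 + Real.sin t ≠ 0 := by positivity
    generalize √(1 - r^2 * Real.sin t ^ 2) = q at *
    have hq' := hq.ne'
    push_cast
    field_simp
    ring
  have hgc : ContinuousOn g (uIcc (0:ℝ) (π/2)) := by
    rw [hu]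
    apply ContinuousOn.add
    · apply ContinuousOn.div (by fun_prop) (by fun_prop)
      intro t ht
      have := hs0 t ht
      positivity
    · apply ContinuousOn.div (by fun_prop) (by fun_prop)
      intro t ht
      exact (Real.sqrt_pos.mpr (hR t)).ne'
  have hI := intervalIntegral.integral_eq_sub_of_hasDerivAt hG hgc.intervalIntegrable
  have hGv : G (π/2) - G 0 = Real.log (2 * (1 + r)) - 1/2 * Real.log (1 - r^2) := by
    simp only [G]
    rw [Real.log_mul (by norm_num) (by positivity)]
    simp
    rw [Real.log_sqrt (by linarith)]
    norm_num
    rw [add_comm r 1]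
    ring
  rw [← hGv, ← hI]
  unfold K
  apply intervalIntegral.integral_mono_on (by positivity) hgc.intervalIntegrable
  · apply Continuous.intervalIntegrable
    apply Continuous.rpow_const (by fun_prop)
    intro t
    exact Or.inl (hR t).ne'
  · intro t ht
    have hs := hs0 t ht
    have hc := hc0 t ht
    have hq := Real.sqrt_pos.mpr (hR t)
    have hs1 := Real.sin_le_one t
    have e : (1 - r^2 * Real.sin t ^ 2) ^ (-(1:ℝ)/2) = 1 / √(1 - r^2 * Real.sin t ^ 2) := by
      rw [neg_div, Real.rpow_neg (hR t).le, ← Real.sqrt_eq_rpow, one_div]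
    rw [e]
    simp only [g]
    have hsq := Real.sq_sqrt (hR t).le
    set q := √(1 - r^2 * Real.sin t ^ 2)
    set s := Real.sin t
    have hcs : Real.cos t ^ 2 = 1 - s^2 := Real.cos_sq' t
    set c := Real.cos t
    have hrs : r * s ≤ s := by nlinarith
    have key : c * q ≤ (1 - r * s) * (1 + s) := by
      have hp : 0 ≤ (1 - r * s) * (1 + s) := mul_nonneg (by linarith) (by linarith)
      refine (abs_le_of_sq_le_sq' ?_ hp).2
      have e1 : ((1 - r * s) * (1 + s))^2 - (c*q)^2 = (1 - r*s) * (1 + s) * (2 * (s - r * s)) := by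
        rw [mul_pow c q, hcs, hsq]; ring
      have : 0 ≤ (1 - r*s) * (1 + s) * (2 * (s - r * s)) := mul_nonneg hp (by linarith)
      linarith
    have : c / (1 + s) ≤ (1 - r * s) / q := by
      rw [div_le_div_iff₀ (by positivity) hq]; exact key
    rw [sub_div] at this
    linarith


theorem f₁_bounds (r : ℝ) (hr : r ∈ Ioo (0:ℝ) 1) :
    (85*π/8 - 185*π^2/32 + 25*π^3/32) < f₁ r ∧ f₁ r < ((8 - 10 * Real.log 2) * π - 85*π^2/32 + 25*π^3/32) := by
  constructor
  · have h := series_f r hr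
    have hr0 := hr.1
    have : 0 < f₁ r - (85*π/8 - 185*π^2/32 + 25*π^3/32) := by
      refine hasSum_lt (i := 0) (fun n => ?_) ?_ hasSum_zero h
      · have := dd_pos n
        positivity
      · have := dd_pos 0
        positivity
    linarith
  · have mono : ∀ a ∈ Ioo (0:ℝ) 1, ∀ b ∈ Ioo (0:ℝ) 1, a < b → f₁ a < f₁ b := by
      intro a ha b hb hab
      have ha0 := ha.1
      have hsq : a^2 < b^2 := by gcongr
      have := hasSum_lt (i := 0) (fun n => ?_) ?_ (series_f a ha) (series_f b hb)
      · linarith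
      · have := dd_pos n
        gcongr
      · have := dd_pos 0
        gcongr
    have hm : (r+1)/2 ∈ Ioo (0:ℝ) 1 := ⟨by linarith [hr.1], by linarith [hr.2]⟩
    refine (mono r hr _ hm (by linarith [hr.2])).trans_le ?_
    let U : ℝ → ℝ := fun s => (8*π - (θ * s^2 + Real.log (2*(1+s))) * (16 + (5*π-16)*s^2)
      + 1/2 * (16-5*π) * ((1-s^2) * Real.log (1-s^2))) / s^4
    have hU : ContinuousAt U 1 := by
      apply ContinuousAt.div
      · apply ContinuousAt.add
        · apply ContinuousAt.sub (by fun_prop)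
          apply ContinuousAt.mul _ (by fun_prop)
          apply ContinuousAt.add (by fun_prop)
          apply ContinuousAt.log (by fun_prop) (by norm_num)
        · apply ContinuousAt.mul (by fun_prop)
          exact (Real.continuous_mul_log.comp (by fun_prop : Continuous fun s : ℝ => 1 - s^2)).continuousAt
      · fun_prop
      · norm_num
    have hU1 : U 1 = (8 - 10 * Real.log 2) * π - 85*π^2/32 + 25*π^3/32 := by
      have : Real.log (2 * (1+1)) = 2 * Real.log 2 := by
        rw [show (2:ℝ) * (1+1) = 2^2 by norm_num, Real.log_pow]; norm_num
      simp only [U, this, θ]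
      norm_num
      ring
    rw [← hU1]
    have ht : Tendsto U (𝓝[<] 1) (𝓝 (U 1)) := hU.tendsto.mono_left nhdsWithin_le_nhds
    refine ge_of_tendsto ht ?_
    filter_upwards [Ioo_mem_nhdsLT hm.2] with s hs
    have hs' : s ∈ Ioo (0:ℝ) 1 := ⟨hm.1.trans hs.1, hs.2⟩
    refine (mono _ hm s hs' hs.1).le.trans ?_
    have hK := K_lower s hs'
    simp only [f₁, U, f]
    have h4 : 0 < s^4 := pow_pos hs'.1 4
    apply div_le_div_of_nonneg_right _ h4.le
    have hx1 : s^2 < 1 := by nlinarith [hs'.1, hs'.2]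
    have hP : 0 ≤ 16 + (5*π-16)*s^2 := by nlinarith [Real.pi_gt_three, sq_nonneg s]
    nlinarith [mul_le_mul_of_nonneg_right hK hP]
end

section
/- For every positive integer k and every r ∈ (0,1), the k-th derivative of the function g₁(r) = g(r)/r² at r is nonpositive; that is, all nonconstant Maclaurin coefficients of g₁ in powers of r² are negative. -/
open Real Set Filter Topology

/-- `lam = 8/5 - log 4`. -/
noncomputable def lam : ℝ := 8/5 - Real.log 4

noncomputable def g (r : ℝ) : ℝ :=
  (lam * r^2 + K r) * (16 + (5*π - 16) * r^2) - (π/2) * (16 - 5 * Real.log (1 - r^2))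

noncomputable def g₁ (r : ℝ) : ℝ := g r / r^2


lemma aux_pow (s t : ℝ) (hs : 0 ≤ s) (hst : s < t) (m : ℕ) :
    m * s^(m-1) * (t - s) ≤ t^m := by
  have h : m * s^(m-1) * (t - s) ≤ t^m - s^m := by
    induction m with
    | zero => simp
    | succ n ih =>
      have h1 : s^n ≤ t^n := pow_le_pow_left₀ hs hst.le n
      rcases Nat.eq_zero_or_pos n with rfl | hn
      · simp
      · have e : s^n = s * s^(n-1) := by
          rw [← pow_succ']; congr 1; omega
        simp only [Nat.add_sub_cancel]
        push_cast
        have h2 := mul_le_mul_of_nonneg_left ih hs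
        have h3 : (n:ℝ) * s^n * (t-s) = s * (n * s^(n-1) * (t-s)) := by rw [e]; ring
        have h4 : 0 ≤ (t-s) * (t^n - s^n) := mul_nonneg (by linarith) (by linarith)
        rw [pow_succ, pow_succ]
        nlinarith
  have : 0 ≤ s^m := by positivity
  linarith

lemma aux_deriv (p : ℕ → ℝ) (e : ℕ → ℕ) (f : ℝ → ℝ)
    (hf : ∀ r ∈ Ioo (0:ℝ) 1, HasSum (fun n => p n * r ^ (e n)) (f r)) :
    ∀ r ∈ Ioo (0:ℝ) 1, HasSum (fun n => (p n * e n) * r ^ (e n - 1)) (deriv f r) := by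
  intro r hr
  obtain ⟨s, hs1, hs2⟩ := exists_between hr.2
  obtain ⟨t, ht1, ht2⟩ := exists_between hs2
  have h0 := hr.1
  have hsum : Summable (fun n => |p n * t ^ (e n)| * (t - s)⁻¹) :=
    ((hf t ⟨by linarith, ht2⟩).summable.abs).mul_right _
  have hb : ∀ n, ∀ y ∈ Ioo 0 s, ‖(p n * e n) * y ^ (e n - 1)‖ ≤ |p n * t ^ (e n)| * (t - s)⁻¹ := by
    intro n y hy
    have hts : 0 < t - s := by linarith
    have h1 := aux_pow s t (by linarith) ht1 (e n)
    have h2 : y ^ (e n - 1) ≤ s ^ (e n - 1) := pow_le_pow_left₀ hy.1.le hy.2.le _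
    have h3 : 0 ≤ y ^ (e n - 1) := pow_nonneg hy.1.le _
    have h4 : (e n : ℝ) * y ^ (e n - 1) ≤ t ^ (e n) * (t - s)⁻¹ := by
      rw [← div_eq_mul_inv, le_div_iff₀ hts]
      refine le_trans ?_ h1
      gcongr
    have ht0 : 0 ≤ t ^ e n := pow_nonneg (by linarith) _
    rw [Real.norm_eq_abs, abs_mul, abs_mul, abs_mul, abs_of_nonneg h3, abs_of_nonneg ht0,
      Nat.abs_cast, mul_assoc, mul_assoc]
    gcongr
  have hd : HasDerivAt (fun z => ∑' n, p n * z ^ (e n)) (∑' n, (p n * e n) * r ^ (e n - 1)) r := by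
    refine hasDerivAt_tsum_of_isPreconnected (t := Ioo 0 s) (y₀ := r)
      (g' := fun n y => (p n * e n) * y ^ (e n - 1)) hsum isOpen_Ioo
      isPreconnected_Ioo ?_ hb ⟨h0, hs1⟩ (hf r hr).summable ⟨h0, hs1⟩
    intro n y _
    have := (hasDerivAt_pow (e n) y).const_mul (p n)
    rwa [← mul_assoc] at this
  have hfe : f =ᶠ[𝓝 r] (fun z => ∑' n, p n * z ^ (e n)) := by
    filter_upwards [isOpen_Ioo.mem_nhds hr] with z hz
    exact (hf z hz).tsum_eq.symm
  rw [hfe.deriv_eq, hd.deriv]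
  exact (Summable.of_norm_bounded hsum (fun n => hb n r ⟨h0, hs1⟩)).hasSum

lemma aux_iter (k : ℕ) : ∀ (p : ℕ → ℝ) (e : ℕ → ℕ) (f : ℝ → ℝ)
    (_ : ∀ r ∈ Ioo (0:ℝ) 1, HasSum (fun n => p n * r ^ (e n)) (f r)) (_ : ∀ n, p n ≤ 0),
    ∀ r ∈ Ioo (0:ℝ) 1, iteratedDeriv k f r ≤ 0 := by
  induction k with
  | zero =>
    intro p e f hf hp r hr
    rw [iteratedDeriv_zero]
    refine (hf r hr).nonpos fun n => mul_nonpos_of_nonpos_of_nonneg (hp n) (pow_nonneg hr.1.le _)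
  | succ k ih =>
    intro p e f hf hp r hr
    rw [iteratedDeriv_succ']
    exact ih _ _ _ (aux_deriv p e f hf)
      (fun n => mul_nonpos_of_nonpos_of_nonneg (hp n) (Nat.cast_nonneg _)) r hr

/-- central coefficients -/
noncomputable def AA (n : ℕ) : ℝ := ∏ i ∈ Finset.range n, (2 * (i : ℝ) + 1) / (2 * i + 2)

lemma AA_succ (n : ℕ) : AA (n+1) = AA n * ((2 * (n : ℝ) + 1) / (2 * n + 2)) :=
  Finset.prod_range_succ _ _

lemma AA_pos (n : ℕ) : 0 < AA n := Finset.prod_pos fun _ _ => by positivity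

lemma AA_W (n : ℕ) : AA n ^ 2 * (2 * n + 1) * Real.Wallis.W n = 1 := by
  induction n with
  | zero => simp [AA, Real.Wallis.W]
  | succ n ih =>
    rw [AA_succ, Real.Wallis.W_succ]
    refine Eq.trans ?_ ih
    push_cast
    field_simp
    ring

lemma AA_bound (n : ℕ) : AA n ^ 2 * (n + 1/4) ≤ 1 / π := by
  have hm : Monotone (fun n : ℕ => AA n ^ 2 * (n + 1/4)) := by
    refine monotone_nat_of_le_succ fun n => ?_
    rw [AA_succ, mul_pow, mul_assoc]
    gcongr
    push_cast
    rw [div_pow, div_mul_eq_mul_div, le_div_iff₀ (by positivity)]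
    have : (0:ℝ) ≤ n := Nat.cast_nonneg n
    nlinarith
  have hl : Tendsto (fun n : ℕ => AA n ^ 2 * (n + 1/4)) atTop (𝓝 (1/π)) := by
    have h1 : Tendsto (fun n : ℕ => (1/2 - (1/4) * (1 / ((n:ℝ) + 1)) * (((n:ℝ)+1)/(2*n+1))) * (Real.Wallis.W n)⁻¹) atTop (𝓝 ((1/2 - 0) * (π/2)⁻¹)) := by
      refine Tendsto.mul ?_ (Real.Wallis.tendsto_W_nhds_pi_div_two.inv₀ (by positivity))
      refine tendsto_const_nhds.sub ?_
      refine squeeze_zero (fun n => by positivity) (fun n => ?_) (tendsto_one_div_add_atTop_nhds_zero_nat (𝕜 := ℝ))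
      have : ((n:ℝ)+1)/(2*n+1) ≤ 1 := by
        rw [div_le_one (by positivity)]; have : (0:ℝ) ≤ n := Nat.cast_nonneg n
        linarith
      have h3 : 0 ≤ 1 / ((n:ℝ)+1) := by positivity
      nlinarith
    convert! h1 using 1
    · ext n
      have h := AA_W n
      have hw := Real.Wallis.W_pos n
      have : AA n ^ 2 = (Real.Wallis.W n)⁻¹ * (2 * (n:ℝ) + 1)⁻¹ := by
        field_simp
        linarith
      rw [this]
      field_simp
      ring
    · congr 1
      field_simp
      norm_num
  exact hm.ge_of_tendsto hl n

lemma choose_AA (n : ℕ) : Ring.choose ((1/2:ℝ) + n - 1) n = AA n := by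
  have h1 : Ring.choose ((1/2:ℝ) + n - 1) n = Ring.multichoose (1/2 : ℝ) n := by
    rw [Ring.choose]; congr 1; ring
  rw [h1]
  have h2 := Ring.factorial_nsmul_multichoose_eq_ascPochhammer (1/2:ℝ) n
  have h3 : (ascPochhammer ℕ n).smeval (1/2:ℝ) = n.factorial * AA n := by
    clear h1 h2
    induction n with
    | zero => simp [AA]
    | succ n ih =>
      rw [ascPochhammer_succ_right, Polynomial.smeval_mul, ih, AA_succ, Nat.factorial_succ]
      simp [Polynomial.smeval_add, Polynomial.smeval_X, Polynomial.smeval_natCast]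
      field_simp
      ring
  rw [h3, nsmul_eq_mul] at h2
  exact mul_left_cancel₀ (by positivity) h2

lemma binom_sum (u : ℝ) (h0 : 0 ≤ u) (h1 : u < 1) :
    HasSum (fun n => AA n * u ^ n) ((1 - u) ^ (-(1:ℝ)/2)) := by
  have h := (Real.one_div_one_sub_rpow_hasFPowerSeriesOnBall_zero (1/2)).hasSum (y := u) (by
    rw [← ENNReal.ofReal_one, Metric.eball_ofReal]
    simp [abs_of_nonneg h0, h1])
  simp only [choose_AA, zero_add] at h
  have e : (1 - u) ^ (-(1:ℝ)/2) = 1 / (1 - u) ^ (1/2:ℝ) := by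
    rw [neg_div, Real.rpow_neg (by linarith), one_div, one_div]
  rw [e]
  convert! h using 1
  funext n
  rw [FormalMultilinearSeries.ofScalars_apply_eq]
  simp

lemma sin_int (n : ℕ) : ∫ t in (0:ℝ)..(π/2), Real.sin t ^ (2*n) = π/2 * AA n := by
  have h := EulerSine.integral_cos_pow_eq (2*n)
  rw [integral_sin_pow_even] at h
  have h2 := intervalIntegral.integral_comp_sub_left (a := 0) (b := π/2) (fun x => Real.cos x ^ (2*n)) (π/2)
  simp only [Real.cos_pi_div_two_sub, sub_self, sub_zero] at h2
  rw [h2, h, AA]; ring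

lemma AA_le_one (n : ℕ) : AA n ≤ 1 := by
  refine Finset.prod_le_one (fun _ _ => by positivity) (fun i _ => ?_)
  rw [div_le_one (by positivity)]; linarith

lemma K_sum (r : ℝ) (hr : r ∈ Ioo (0:ℝ) 1) :
    HasSum (fun n => (π/2) * (AA n ^ 2 * (r^2) ^ n)) (K r) := by
  have h0 := hr.1
  have hr2 : r^2 < 1 := by nlinarith [hr.2]
  have key : HasSum (fun n => ∫ t in (0:ℝ)..(π/2), AA n * (r^2 * Real.sin t ^ 2) ^ n) (K r) := by
    unfold K
    refine intervalIntegral.hasSum_integral_of_dominated_convergence (fun n _ => (r^2)^n)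
      ?_ ?_ ?_ ?_ ?_
    · intro n
      exact Continuous.aestronglyMeasurable (by fun_prop)
    · intro n
      refine Eventually.of_forall fun t _ => ?_
      have h1 : r^2 * Real.sin t ^ 2 ≤ r^2 :=
        mul_le_of_le_one_right (by positivity) (Real.sin_sq_le_one t)
      rw [Real.norm_eq_abs, abs_of_nonneg (mul_nonneg (AA_pos n).le (by positivity))]
      calc AA n * (r^2 * Real.sin t ^ 2) ^ n ≤ 1 * (r^2)^n := by
            gcongr
            exact AA_le_one n
        _ = _ := one_mul _
    · exact Eventually.of_forall fun t _ => summable_geometric_of_lt_one (by positivity) hr2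
    · exact intervalIntegrable_const
    · refine Eventually.of_forall fun t _ => ?_
      refine binom_sum _ (by positivity) ?_
      have h1 : r^2 * Real.sin t ^ 2 ≤ r^2 :=
        mul_le_of_le_one_right (by positivity) (Real.sin_sq_le_one t)
      linarith
  convert! key using 1
  funext n
  have : ∀ t : ℝ, AA n * (r^2 * Real.sin t ^ 2) ^ n = (AA n * (r^2)^n) * Real.sin t ^ (2*n) := by
    intro t; rw [mul_pow, pow_mul (Real.sin t)]; ring
  simp only [this]
  rw [intervalIntegral.integral_const_mul, sin_int]
  ring

/-- coefficients of g₁ -/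
noncomputable def BB (n : ℕ) : ℝ :=
  (π/2) * (16 * AA (n+1) ^ 2 + (5*π - 16) * AA n ^ 2 - 5 * (1 / (n+1)))
    + ((if n = 0 then 16 * lam else 0) + (if n = 1 then lam * (5*π-16) else 0))

lemma g₁_sum (r : ℝ) (hr : r ∈ Ioo (0:ℝ) 1) :
    HasSum (fun n => BB n * r ^ (2*n)) (g₁ r) := by
  have h0 := hr.1
  have hr2 : r^2 < 1 := by nlinarith [hr.2]
  have hK := K_sum r hr
  have hK1 : HasSum (fun n => (π/2) * (AA (n+1) ^ 2 * (r^2) ^ n)) ((K r - π/2) / r^2) := by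
    have := ((hasSum_nat_add_iff' 1).mpr hK).div_const (r^2)
    simp only [Finset.sum_range_one] at this
    convert! this using 1
    · funext n
      field_simp
      ring
    · simp [AA]
  have hL : HasSum (fun n : ℕ => (r^2)^n / ((n:ℝ)+1)) (-Real.log (1 - r^2) / r^2) := by
    have := (Real.hasSum_pow_div_log_of_abs_lt_one (x := r^2)
      (by rwa [abs_of_nonneg (by positivity)])).div_const (r^2)
    convert! this using 1
    funext n
    field_simp
    ring
  have hA : HasSum (fun n : ℕ => if n = 0 then 16 * lam else 0) (16 * lam) := hasSum_ite_eq 0 _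
  have hB : HasSum (fun n : ℕ => if n = 1 then lam * (5*π-16) * r^2 else 0) (lam * (5*π-16) * r^2) :=
    hasSum_ite_eq 1 _
  have := (((hK1.mul_left 16).add (hK.mul_left (5*π-16))).sub (hL.mul_left (5*π/2))).add (hA.add hB)
  convert! this using 1
  · funext n
    unfold BB
    rw [pow_mul]
    rcases n with _ | _ | n
    · simp; ring
    · simp; ring
    · simp; ring
  · unfold g₁ g
    field_simp
    ring

lemma BB_nonpos (n : ℕ) (hn : 0 < n) : BB n ≤ 0 := by
  have hpi : π < 3.15 := Real.pi_lt_d2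
  have hp0 := Real.pi_gt_three
  have hlam : 0 ≤ lam := by
    unfold lam
    have h2 := Real.log_two_lt_d9
    have : Real.log 4 = 2 * Real.log 2 := by
      rw [show (4:ℝ) = 2^2 by norm_num, Real.log_pow]; norm_num
    rw [this]; linarith
  have h1 : 16 * AA (n+1) ^ 2 + (5*π - 16) * AA n ^ 2 - 5 * (1 / (n+1)) ≤ 0 := by
    have hb := AA_bound n
    rw [AA_succ, mul_pow]
    have hx : (1:ℝ) ≤ n := by exact_mod_cast hn
    generalize (n:ℝ) = x at *
    have hc : 0 ≤ AA n ^ 2 := by positivity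
    generalize AA n ^ 2 = c at *
    rw [le_div_iff₀ (by positivity)] at hb
    have e : 16 * (c * ((2*x+1)/(2*x+2))^2) + (5*π-16)*c - 5*(1/(x+1)) =
      (c * (5*π*(x+1)^2 - 16*(x+1) + 4) - 5*(x+1)) / (x+1)^2 := by
      field_simp
      ring
    rw [e]
    apply div_nonpos_of_nonpos_of_nonneg _ (by positivity)
    have h5 : c * (5*π*(x+1)^2 - 16*(x+1) + 4) ≤ c * (5 * (x+1) * ((x+1/4)*π)) := by
      apply mul_le_mul_of_nonneg_left _ hc
      nlinarith
    have h6 : 5 * (x+1) * (c * (x+1/4) * π) ≤ 5 * (x+1) * 1 :=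
      mul_le_mul_of_nonneg_left hb (by positivity)
    linarith
  have h2 : (if n = 1 then lam * (5*π-16) else 0) ≤ 0 := by
    split_ifs
    · exact mul_nonpos_of_nonneg_of_nonpos hlam (by linarith)
    · exact le_rfl
  unfold BB
  rw [if_neg hn.ne']
  have := mul_nonpos_of_nonneg_of_nonpos (by positivity : 0 ≤ π/2) h1
  linarith

theorem g₁_derivs_nonpos (k : ℕ) (hk : 0 < k) (r : ℝ) (hr : r ∈ Ioo (0:ℝ) 1) :
    iteratedDeriv k g₁ r ≤ 0 := by
  obtain ⟨k, rfl⟩ : ∃ m, k = m + 1 := ⟨k - 1, by omega⟩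
  rw [iteratedDeriv_succ']
  refine aux_iter k _ _ _ (aux_deriv BB (fun n => 2*n) g₁ g₁_sum) (fun n => ?_) r hr
  rcases Nat.eq_zero_or_pos n with rfl | hn
  · simp
  · exact mul_nonpos_of_nonpos_of_nonneg (BB_nonpos n hn) (Nat.cast_nonneg _)
end

section
/- For every r ∈ (0,1), K(r) < (π[16 − 5 log(1 − r²)] − 2α r⁴)/(32 + 2(5π − 16)r²) − θ r², where θ = π(17 − 5π)/32 and α = 85π/8 − 185π²/32 + 25π³/32. -/
open Real Set Filter Topology

noncomputable def pp (n : ℕ) : ℝ := ∏ i ∈ Finset.range n, (2 * (i : ℝ) + 1) / (2 * i + 2)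

lemma pp_succ (n : ℕ) : pp (n+1) = pp n * ((2 * (n : ℝ) + 1) / (2 * n + 2)) :=
  Finset.prod_range_succ _ _

lemma pp_zero : pp 0 = 1 := by simp [pp]

lemma pp_pos (n : ℕ) : 0 < pp n := by
  unfold pp
  apply Finset.prod_pos
  intro i _
  positivity

lemma pp_le_one (n : ℕ) : pp n ≤ 1 := by
  unfold pp
  apply Finset.prod_le_one
  · intro i _
    positivity
  · intro i _
    rw [div_le_one (by positivity)]
    linarith

lemma pp_eq (n : ℕ) : Ring.choose ((1/2:ℝ) + n - 1) n = pp n := by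
  rw [← Ring.multichoose_eq]
  have h := Ring.factorial_nsmul_multichoose_eq_ascPochhammer (1/2:ℝ) n
  rw [Polynomial.ascPochhammer_smeval_eq_eval] at h
  have h2 : ∀ n : ℕ, (ascPochhammer ℝ n).eval (1/2:ℝ) = n.factorial * pp n := by
    intro n
    induction n with
    | zero => simp [pp_zero]
    | succ k ih =>
      rw [ascPochhammer_succ_eval, ih, pp_succ, Nat.factorial_succ]
      push_cast
      field_simp
      ring
  rw [h2, nsmul_eq_mul] at h
  exact mul_left_cancel₀ (by exact_mod_cast Nat.factorial_ne_zero n) h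

lemma hasSum_pp (y : ℝ) (h0 : 0 ≤ y) (h1 : y < 1) :
    HasSum (fun n => pp n * y ^ n) ((1 - y) ^ (-(1:ℝ)/2)) := by
  have h := (Real.one_div_one_sub_rpow_hasFPowerSeriesOnBall_zero (1/2)).hasSum (y := y)
    (by simp [enorm_eq_nnnorm, ← NNReal.coe_lt_coe, abs_of_nonneg h0, h1])
  simp only [FormalMultilinearSeries.ofScalars_apply_eq, pp_eq, zero_add, smul_eq_mul] at h
  rw [show (-(1:ℝ)/2) = -(1/2) by ring, Real.rpow_neg (by linarith), ← one_div]
  exact h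

lemma integral_sin_half (n : ℕ) :
    ∫ t in (0:ℝ)..(π/2), Real.sin t ^ (2*n) = π / 2 * pp n := by
  have h := EulerSine.integral_cos_pow_eq (2*n)
  rw [integral_sin_pow_even] at h
  have h2 := intervalIntegral.integral_comp_sub_left (a := 0) (b := π/2)
    (fun t => Real.cos t ^ (2*n)) (π/2)
  simp only [Real.cos_pi_div_two_sub, sub_self, sub_zero] at h2
  rw [h2, h, pp]
  ring

lemma hasSum_K (r : ℝ) (hr : r ∈ Ioo (0:ℝ) 1) :
    HasSum (fun n => π / 2 * pp n ^ 2 * (r^2) ^ n) (K r) := by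
  obtain ⟨h0, h1⟩ := hr
  have hx : r^2 < 1 := by nlinarith
  have hx0 : 0 ≤ r^2 := sq_nonneg r
  have := intervalIntegral.hasSum_integral_of_dominated_convergence (μ := MeasureTheory.volume)
    (a := 0) (b := π/2) (F := fun n t => pp n * (r^2 * Real.sin t ^ 2)^n)
    (f := fun t => (1 - r^2 * Real.sin t ^ 2) ^ (-(1:ℝ)/2))
    (fun n _ => (r^2)^n) ?_ ?_ ?_ ?_ ?_
  · unfold K
    refine Eq.mp (congrArg (fun f => HasSum f _) ?_) this
    funext n
    simp only [mul_pow, ← pow_mul, intervalIntegral.integral_const_mul, integral_sin_half]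
    ring
  · intro n
    apply Continuous.aestronglyMeasurable
    fun_prop
  · intro n
    refine Eventually.of_forall fun t _ => ?_
    rw [Real.norm_of_nonneg (mul_nonneg (pp_pos n).le (by positivity))]
    have : (r^2 * Real.sin t ^ 2)^n ≤ (r^2)^n := by
      gcongr
      nlinarith [Real.sin_sq_le_one t]
    have h3 : 0 ≤ (r^2 * Real.sin t ^ 2)^n := by positivity
    nlinarith [pp_le_one n]
  · exact Eventually.of_forall fun t _ => summable_geometric_of_lt_one hx0 hx
  · exact intervalIntegrable_const
  · refine Eventually.of_forall fun t _ => ?_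
    apply hasSum_pp _ (by positivity)
    nlinarith [Real.sin_sq_le_one t]

lemma W_pp (n : ℕ) : Real.Wallis.W n * (pp n ^ 2 * (2 * n + 1)) = 1 := by
  induction n with
  | zero => simp [pp_zero, Real.Wallis.W]
  | succ k ih =>
    rw [Real.Wallis.W_succ, pp_succ]
    push_cast
    refine Eq.trans ?_ ih
    field_simp
    ring

lemma pp_bound (n : ℕ) : pp n ^ 2 * n * π < 1 := by
  have h := Real.Wallis.le_W n
  have h2 := W_pp n
  have hp : 0 < pp n ^ 2 := by have := pp_pos n; positivity
  have h3 : (2 * (n:ℝ) + 1) / (2 * n + 2) * (π / 2) * (pp n ^ 2 * (2 * n + 1)) ≤ 1 := by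
    refine le_trans ?_ h2.le
    gcongr
  refine lt_of_lt_of_le ?_ h3
  have h4 : 0 < pp n ^ 2 * π := by have := Real.pi_pos; positivity
  have h5 : (n:ℝ) < (2 * (n:ℝ) + 1) / (2 * n + 2) * (1 / 2) * (2 * n + 1) := by
    rw [div_mul_eq_mul_div, div_mul_eq_mul_div, lt_div_iff₀ (by positivity)]
    nlinarith
  nlinarith [mul_lt_mul_of_pos_left h5 h4]

lemma coef_pos (n : ℕ) : 0 < 5 / ((n:ℝ)+1) - 16 * pp (n+1) ^ 2 - (5 * π - 16) * pp n ^ 2 := by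
  have hb := pp_bound (n+1)
  push_cast at hb
  have hpi : 5 * π - 16 < 0 := by linarith [Real.pi_lt_d2]
  have h1 : pp (n+1)^2 ≤ pp n ^2 := by
    have h0 := (pp_pos n).le
    rw [pp_succ, mul_pow]
    have : ((2 * (n : ℝ) + 1) / (2 * n + 2))^2 ≤ 1 := by
      apply pow_le_one₀ (by positivity)
      rw [div_le_one (by positivity)]
      linarith
    nlinarith [sq_nonneg (pp n)]
  have h2 : 5 * π * pp (n+1)^2 < 5 / ((n:ℝ)+1) := by
    rw [lt_div_iff₀ (by positivity)]
    linarith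
  nlinarith

theorem K_upper_f (r : ℝ) (hr : r ∈ Ioo (0:ℝ) 1) :
    K r < (π * (16 - 5 * Real.log (1 - r^2)) - 2 * (85*π/8 - 185*π^2/32 + 25*π^3/32) * r^4) /
        (32 + 2*(5*π - 16)*r^2) - π * (17 - 5*π) / 32 * r^2 := by
  have hK := hasSum_K r hr
  obtain ⟨h0, h1⟩ := hr
  have hx1 : r^2 < 1 := by nlinarith
  have hx0 : 0 < r^2 := by positivity
  have hr4 : r^4 = (r^2)^2 := by ring
  rw [hr4]
  generalize r^2 = x at *
  have hL := Real.hasSum_pow_div_log_of_abs_lt_one (x := x) (by rwa [abs_of_pos hx0])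
  have hK1 := (hasSum_nat_add_iff' 1).2 hK
  have hS := ((hL.mul_left (5 * π / 2)).sub (hK1.mul_left 16)).sub
    (hK.mul_left ((5 * π - 16) * x))
  have hpi := Real.pi_pos
  have hterm : ∀ n : ℕ, 5 * π / 2 * (x ^ (n + 1) / (n + 1)) -
      16 * (π / 2 * pp (n + 1) ^ 2 * x ^ (n + 1)) -
      (5 * π - 16) * x * (π / 2 * pp n ^ 2 * x ^ n) =
      π / 2 * x ^ (n+1) * (5 / ((n:ℝ)+1) - 16 * pp (n+1) ^ 2 - (5 * π - 16) * pp n ^ 2) := by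
    intro n
    ring
  have hpos : ∀ n : ℕ, 0 < π / 2 * x ^ (n+1) *
      (5 / ((n:ℝ)+1) - 16 * pp (n+1) ^ 2 - (5 * π - 16) * pp n ^ 2) := by
    intro n
    have := coef_pos n
    positivity
  simp only [hterm] at hS
  have hle := sum_le_hasSum (Finset.range 3) (fun i _ => (hpos i).le) hS
  have h2 := hpos 2
  simp only [Finset.sum_range_succ, Finset.sum_range_zero] at hle
  have e1 : pp 1 = 1/2 := by rw [pp_succ, pp_zero]; norm_num
  have e2 : pp 2 = 3/8 := by rw [pp_succ, e1]; norm_num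
  have hlt := lt_of_lt_of_le (lt_add_of_pos_right _ h2) hle
  simp only [zero_add, pp_zero, e1, e2, Nat.reduceAdd] at hlt
  norm_num at hlt
  have hden : 0 < 32 + 2*(5*π - 16)*x := by nlinarith [Real.pi_gt_three]
  rw [lt_sub_iff_add_lt, lt_div_iff₀ hden]
  nlinarith
end
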